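/- arXiv:2601.00122 — 2 statements merged into one kernel-verified Lean document; each statement's English description precedes it below -/
import Mathlib

section
/- Let A = (a_1,...,a_n) be distinct elements of F_q and 1 < k < n-1. The permutation group Per(RS(A,k)) is isomorphic to the group of degree-one polynomials over F_q that permute the set {a_1,...,a_n}, under composition. -/
open Polynomial

/-- The denominators `∏_{j ≠ i} (a i - a j)` of the Lagrange functional extracting the top
coefficient of an interpolating polynomial. -/
def lagrangeDenom {F : Type*} [Field F] {n : ℕ} (a : Fin n → F) (i : Fin n) : F :=
  ∏ j ∈ Finset.univ.erase i, (a i - a j)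

theorem lagrangeDenom_ne_zero {F : Type*} [Field F] {n : ℕ} {a : Fin n → F}
    (ha : Function.Injective a) (i : Fin n) : lagrangeDenom a i ≠ 0 :=
  Finset.prod_ne_zero_iff.2 fun _ hj =>
    sub_ne_zero.2 fun h => (Finset.ne_of_mem_erase hj) (ha h).symm

theorem coeff_eq_sum_div_lagrangeDenom {F : Type*} [Field F] {n : ℕ} {a : Fin n → F}
    (ha : Function.Injective a) {f : F[X]} (hf : f.degree < n) :
    f.coeff (n - 1) = ∑ i, f.eval (a i) / lagrangeDenom a i := by
  simpa [lagrangeDenom] using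
    Lagrange.coeff_eq_sum (s := Finset.univ) (v := a) ha.injOn (P := f) (by simpa using hf)

theorem eq_of_degree_lt_of_eval_eq {F : Type*} [Field F] {n : ℕ} {a : Fin n → F}
    (ha : Function.Injective a) {f g : F[X]} (hf : f.degree < n) (hg : g.degree < n)
    (h : ∀ i, f.eval (a i) = g.eval (a i)) : f = g :=
  eq_of_degrees_lt_of_eval_index_eq (s := Finset.univ) (v := a) ha.injOn
    (by simpa using hf) (by simpa using hg) fun i _ => h i

/-- A polynomial orthogonal to the Reed-Solomon code of dimension `k` has degree less than
`n - k`. -/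
theorem natDegree_add_lt_of_moments_eq_zero {F : Type*} [Field F] {n k : ℕ} {a : Fin n → F}
    (ha : Function.Injective a) {u : F[X]} (hu0 : u ≠ 0) (hu : u.natDegree < n)
    (h : ∀ j < k, ∑ i, u.eval (a i) * a i ^ j / lagrangeDenom a i = 0) :
    u.natDegree + k < n := by
  by_contra! hlt
  have hdeg : (u * X ^ (n - 1 - u.natDegree)).natDegree = n - 1 := by
    rw [natDegree_mul_X_pow _ hu0]
    omega
  have hne : u * X ^ (n - 1 - u.natDegree) ≠ 0 := mul_ne_zero hu0 (pow_ne_zero _ X_ne_zero)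
  have hc := coeff_eq_sum_div_lagrangeDenom ha (f := u * X ^ (n - 1 - u.natDegree))
    ((natDegree_lt_iff_degree_lt hne).1 (by omega))
  simp only [eval_mul, eval_pow, eval_X] at hc
  rw [h _ (by omega)] at hc
  exact hne (leadingCoeff_eq_zero.1 (by rwa [leadingCoeff, hdeg]))

/-- A permutation preserving a Reed-Solomon code is induced by a polynomial of degree one. -/
theorem exists_degree_eq_one_of_preserves {F : Type*} [Field F] {n k : ℕ}
    (hk : 1 < k) (hkn : k < n - 1) {a : Fin n → F} (ha : Function.Injective a)
    {π : Equiv.Perm (Fin n)}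
    (hpull : ∀ f : F[X], f.degree < k →
      ∃ r : F[X], r.degree < k ∧ ∀ i, r.eval (a i) = f.eval (a (π i)))
    (hpush : ∀ f : F[X], f.degree < k →
      ∃ r : F[X], r.degree < k ∧ ∀ i, r.eval (a (π i)) = f.eval (a i)) :
    ∃ p : F[X], p.degree = 1 ∧ ∀ i, p.eval (a i) = a (π i) := by
  have hXk : ∀ j < k, (X ^ j : F[X]).degree < k := fun j hj => by
    rw [degree_X_pow]; exact_mod_cast hj
  obtain ⟨p, hpk, hp⟩ := hpull X (by simpa using hXk 1 hk)
  simp only [eval_X] at hp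
  let g := Lagrange.interpolate Finset.univ a fun i => lagrangeDenom a i / lagrangeDenom a (π i)
  have hg (i : Fin n) : g.eval (a i) = lagrangeDenom a i / lagrangeDenom a (π i) :=
    Lagrange.eval_interpolate_at_node _ ha.injOn (Finset.mem_univ i)
  have hgn : g.degree < n := by
    simpa only [Finset.card_univ, Fintype.card_fin] using Lagrange.degree_interpolate_lt
      (fun i => lagrangeDenom a i / lagrangeDenom a (π i)) (s := Finset.univ) ha.injOn
  have i₀ : Fin n := ⟨0, by omega⟩
  have hg0 : g ≠ 0 := fun h => by
    have := hg i₀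
    rw [h, eval_zero] at this
    exact div_ne_zero (lagrangeDenom_ne_zero ha _) (lagrangeDenom_ne_zero ha _) this.symm
  have hp0 : p.natDegree ≠ 0 := fun h => by
    obtain ⟨c, hc⟩ := natDegree_eq_zero.1 h
    have h01 : a (π ⟨0, by omega⟩) = a (π ⟨1, by omega⟩) := by
      rw [← hp, ← hp, ← hc, eval_C, eval_C]
    simpa using π.injective (ha h01)
  have hpne : p ≠ 0 := fun h => hp0 (by simp [h])
  have hpk' : p.natDegree < k := (natDegree_lt_iff_degree_lt hpne).2 hpk
  have hsum (f : F[X]) (hf : f.degree < ((n - 1 : ℕ) : WithBot ℕ)) :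
      ∑ i, g.eval (a i) * f.eval (a (π i)) / lagrangeDenom a i = 0 := by
    have hrw (i : Fin n) : g.eval (a i) * f.eval (a (π i)) / lagrangeDenom a i =
        f.eval (a (π i)) / lagrangeDenom a (π i) := by
      have := lagrangeDenom_ne_zero ha i
      have := lagrangeDenom_ne_zero ha (π i)
      rw [hg]
      field_simp
    rw [Finset.sum_congr rfl fun i _ => hrw i,
      Equiv.sum_comp π fun i => f.eval (a i) / lagrangeDenom a i,
      ← coeff_eq_sum_div_lagrangeDenom ha
        (hf.trans_le (by exact_mod_cast Nat.sub_le n 1)),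
      coeff_eq_zero_of_degree_lt hf]
  have hgk : g.natDegree + k < n := by
    refine natDegree_add_lt_of_moments_eq_zero ha hg0
      ((natDegree_lt_iff_degree_lt hg0).2 hgn) fun j hj => ?_
    obtain ⟨f, hfk, hf⟩ := hpush (X ^ j) (hXk j hj)
    simp only [eval_pow, eval_X] at hf
    simp only [← hf]
    exact hsum f (hfk.trans (by exact_mod_cast hkn))
  have hgp : g.natDegree + p.natDegree + k < n := by
    rw [← natDegree_mul hg0 hpne]
    refine natDegree_add_lt_of_moments_eq_zero ha (mul_ne_zero hg0 hpne)
      (by rw [natDegree_mul hg0 hpne]; omega) fun j hj => ?_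
    obtain ⟨f, hfk, hf⟩ := hpush (X ^ j) (hXk j hj)
    simp only [eval_pow, eval_X] at hf
    rw [← hsum (X * f)]
    · simp only [eval_mul, eval_X, hf, hp, mul_assoc]
    · by_cases hf0 : f = 0
      · simp [hf0]
      · rw [← natDegree_lt_iff_degree_lt (mul_ne_zero X_ne_zero hf0), natDegree_X_mul hf0]
        have := (natDegree_lt_iff_degree_lt hf0).2 hfk
        omega
  suffices hp1 : p.natDegree = 1 from
    ⟨p, (degree_eq_iff_natDegree_eq hpne).2 hp1, hp⟩
  by_contra hp1
  obtain ⟨j, hj, hjk, hjn⟩ : ∃ j < k, k ≤ j * p.natDegree ∧ j * p.natDegree < n := by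
    have hd : 2 ≤ p.natDegree := by omega
    have h1 := Nat.div_add_mod (k - 1) p.natDegree
    have h2 := Nat.mod_lt (k - 1) (show 0 < p.natDegree by omega)
    have h3 := Nat.mul_le_mul_right ((k - 1) / p.natDegree) hd
    have h4 : 1 ≤ (k - 1) / p.natDegree := (Nat.one_le_div_iff (by omega)).2 (by omega)
    refine ⟨(k - 1) / p.natDegree + 1, by omega, ?_, ?_⟩ <;>
      rw [add_mul, one_mul, mul_comm] <;> omega
  obtain ⟨r, hrk, hr⟩ := hpull (X ^ j) (hXk j hj)
  have hpj : p ^ j ≠ 0 := pow_ne_zero _ hpne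
  have hrp : r = p ^ j := by
    refine eq_of_degree_lt_of_eval_eq ha (hrk.trans (by exact_mod_cast (by omega : k < n))) ?_
      fun i => by simp [hr, hp]
    rwa [← natDegree_lt_iff_degree_lt hpj, natDegree_pow]
  rw [hrp, ← natDegree_lt_iff_degree_lt hpj, natDegree_pow] at hrk
  omega

/-- Composing with a polynomial of degree one preserves bounds on the degree. -/
theorem degree_comp_lt_of_natDegree_le_one {F : Type*} [Field F] {f p : F[X]} {k : ℕ}
    (hf : f.degree < k) (hp : p.natDegree ≤ 1) : (f.comp p).degree < k := by
  by_cases hc : f.comp p = 0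
  · simp [hc]
  · have hf0 : f ≠ 0 := fun h => hc (by simp [h])
    rw [← natDegree_lt_iff_degree_lt hc, natDegree_comp]
    have := (natDegree_lt_iff_degree_lt hf0).2 hf
    have := Nat.mul_le_mul_left f.natDegree hp
    omega

/-- A polynomial of degree one has a compositional left inverse of degree one. -/
theorem exists_comp_eq_X_of_degree_eq_one {F : Type*} [Field F] {p : F[X]}
    (hp : p.degree = 1) : ∃ q : F[X], q.natDegree ≤ 1 ∧ q.comp p = X := by
  have hlc : p.leadingCoeff ≠ 0 := leadingCoeff_ne_zero.2 fun h => by simp [h] at hp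
  refine ⟨C p.leadingCoeff⁻¹ * (X - C (p.coeff 0)), ?_, ?_⟩
  · exact (natDegree_C_mul_le _ _).trans (natDegree_X_sub_C _).le
  · rw [mul_comp, C_comp, sub_comp, X_comp, C_comp,
      sub_eq_of_eq_add (eq_X_add_C_of_degree_eq_one hp), ← mul_assoc, ← C_mul,
      inv_mul_cancel₀ hlc, C_1, one_mul]

/-- For 1 < k < n-1, Per(RS(A,k)) is isomorphic to the group of
degree-one polynomials permuting {a_1,...,a_n} under composition. -/
theorem perm_group_RS_iso_affine {F : Type*} [Field F] [Fintype F] {n k : ℕ}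
    (hk : 1 < k) (hkn : k < n - 1)
    (a : Fin n → F) (ha : Function.Injective a) :
    ∃ Φ : {π : Equiv.Perm (Fin n) //
        (fun v : Fin n → F => fun i => v (π i)) ''
            {v : Fin n → F | ∃ f : F[X], f.degree < (k : ℕ) ∧ v = fun i => f.eval (a i)} =
          {v : Fin n → F | ∃ f : F[X], f.degree < (k : ℕ) ∧ v = fun i => f.eval (a i)}} →
      {p : F[X] // p.degree = 1 ∧
        Set.BijOn (fun x => p.eval x) (Set.range a) (Set.range a)},
      Function.Bijective Φ ∧
      ∀ (π₁ π₂ : Equiv.Perm (Fin n)) (h₁ : _) (h₂ : _) (h₁₂ : _),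
        (Φ ⟨π₁ * π₂, h₁₂⟩).1 = ((Φ ⟨π₁, h₁⟩).1).comp (Φ ⟨π₂, h₂⟩).1 := by
  have hC : ∀ π : Equiv.Perm (Fin n), ((fun v : Fin n → F => fun i => v (π i)) ''
            {v : Fin n → F | ∃ f : F[X], f.degree < (k : ℕ) ∧ v = fun i => f.eval (a i)} =
          {v : Fin n → F | ∃ f : F[X], f.degree < (k : ℕ) ∧ v = fun i => f.eval (a i)}) ↔
      ∃ p : F[X], p.degree = 1 ∧ ∀ i, p.eval (a i) = a (π i) := by
    intro π
    constructor
    · intro h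
      refine exists_degree_eq_one_of_preserves hk hkn ha (fun f hf => ?_) fun f hf => ?_
      · obtain ⟨r, hr, hrf⟩ := h.subset ⟨_, ⟨f, hf, rfl⟩, rfl⟩
        exact ⟨r, hr, fun i => (congrFun hrf i).symm⟩
      · obtain ⟨_, ⟨r, hr, rfl⟩, hrf⟩ := h.superset ⟨f, hf, rfl⟩
        exact ⟨r, hr, fun i => congrFun hrf i⟩
    · rintro ⟨p, hp, hpa⟩
      apply Set.Subset.antisymm
      · rintro _ ⟨_, ⟨f, hf, rfl⟩, rfl⟩
        exact ⟨f.comp p, degree_comp_lt_of_natDegree_le_one hf (natDegree_le_of_degree_le hp.le),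
          funext fun i => by simp [hpa]⟩
      · rintro _ ⟨f, hf, rfl⟩
        obtain ⟨q, hq, hqp⟩ := exists_comp_eq_X_of_degree_eq_one hp
        refine ⟨_, ⟨f.comp q, degree_comp_lt_of_natDegree_le_one hf hq, rfl⟩, funext fun i => ?_⟩
        simp only [← hpa]
        rw [← eval_comp, comp_assoc, hqp, comp_X]
  have hone {p : F[X]} (hp : p.natDegree ≤ 1) : p.degree < n :=
    (degree_le_of_natDegree_le hp).trans_lt (by exact_mod_cast (by omega : 1 < n))
  choose P hP1 hPa using fun π => (hC π).1
  refine ⟨fun π => ⟨P π.1 π.2, hP1 _ _, ?_⟩, ⟨?_, ?_⟩, ?_⟩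
  · refine ⟨?_, ?_, ?_⟩
    · rintro _ ⟨i, rfl⟩
      exact ⟨π.1 i, (hPa _ _ i).symm⟩
    · rintro _ ⟨i, rfl⟩ _ ⟨j, rfl⟩ h
      simp only [hPa] at h
      rw [π.1.injective (ha h)]
    · rintro _ ⟨i, rfl⟩
      exact ⟨_, ⟨π.1.symm i, rfl⟩, by simp [hPa]⟩
  · rintro ⟨π₁, h₁⟩ ⟨π₂, h₂⟩ h
    have h' : P π₁ h₁ = P π₂ h₂ := congrArg Subtype.val h
    refine Subtype.ext (Equiv.ext fun i => ha ?_)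
    rw [← hPa π₁ h₁, ← hPa π₂ h₂, h']
  · rintro ⟨p, hp, hmaps, hinj, -⟩
    choose σ hσ using fun i => hmaps ⟨i, rfl⟩
    have hσi : Function.Injective σ := fun i j h => by
      refine ha (hinj ⟨i, rfl⟩ ⟨j, rfl⟩ ?_)
      rw [← hσ i, ← hσ j, h]
    let π := Equiv.ofBijective σ (Finite.injective_iff_bijective.1 hσi)
    have hπ (i : Fin n) : p.eval (a i) = a (π i) := (hσ i).symm
    refine ⟨⟨π, (hC π).2 ⟨p, hp, hπ⟩⟩, Subtype.ext ?_⟩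
    refine eq_of_degree_lt_of_eval_eq ha (hone (natDegree_le_of_degree_le (hP1 _ _).le))
      (hone (natDegree_le_of_degree_le hp.le)) fun i => ?_
    rw [hPa, hπ]
  · intro π₁ π₂ h₁ h₂ h₁₂
    have hd (π) (h) : (P π h).natDegree = 1 := natDegree_eq_of_degree_eq_some (hP1 π h)
    refine eq_of_degree_lt_of_eval_eq ha (hone (hd _ _).le)
      (hone (by simp only [natDegree_comp, hd]; exact le_rfl)) fun i => ?_
    simp only [eval_comp, hPa, Equiv.Perm.mul_apply]
end

section
/- Over F_13, let A = (0,1,4,6) and k = 3 = n-1. The permutation group Per(RS(A,3)) is isomorphic to S_3, while the group of degree-one polynomials permuting {0,1,4,6} has exactly three elements, namely x, 3x+1, 9x+4. Hence for k = n-1 the permutation group can strictly contain the affine permutations of A. -/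
open Polynomial

namespace ReedSolomonExample

/-- The code `RS(A, 3)` over `F_13` is the hyperplane orthogonal to `(1, 1, 1, 10)`. -/
lemma exists_degree_lt_three_iff (v : Fin 4 → ZMod 13) :
    (∃ f : (ZMod 13)[X], f.degree < (3 : ℕ) ∧
      v = fun i => f.eval ((![0, 1, 4, 6] : Fin 4 → ZMod 13) i)) ↔
      v 0 + v 1 + v 2 + 10 * v 3 = 0 := by
  constructor
  · rintro ⟨f, hf, rfl⟩
    have hnat : f.natDegree < 3 := by
      by_cases h0 : f = 0
      · simp [h0]
      · exact (natDegree_lt_iff_degree_lt h0).2 hf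
    simp only [eval_eq_sum_range' hnat, Finset.sum_range_succ, Finset.sum_range_zero]
    simp
    ring_nf
    reduce_mod_char
  · intro h
    refine ⟨C (4 * (v 1 - v 0) - (v 2 - v 0)) * X ^ 2 +
      C ((v 2 - v 0) - 3 * (v 1 - v 0)) * X + C (v 0), ?_, ?_⟩
    · exact degree_quadratic_lt
    · have h13 : (13 : ZMod 13) = 0 := by decide
      funext i
      fin_cases i
      · simp
      · simp
        ring
      · simp
        linear_combination (-4 * v 1 + v 2 + 3 * v 0) * h13
      · simp
        linear_combination (norm := (ring_nf; reduce_mod_char)) 4 * h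

lemma dual_apply_perm {π : Equiv.Perm (Fin 4)} (h : π 3 = 3) (v : Fin 4 → ZMod 13) :
    v (π 0) + v (π 1) + v (π 2) + 10 * v (π 3) = v 0 + v 1 + v 2 + 10 * v 3 := by
  have hsum := Equiv.sum_comp π v
  simp only [Fin.sum_univ_four, h] at hsum ⊢
  linear_combination hsum

set_option maxRecDepth 10000 in
lemma apply_three_of_dual : ∀ π : Equiv.Perm (Fin 4),
    (![3, 0, 0, 1] : Fin 4 → ZMod 13) (π 0) + ![3, 0, 0, 1] (π 1) + ![3, 0, 0, 1] (π 2) +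
      10 * ![3, 0, 0, 1] (π 3) = 0 → π 3 = 3 := by
  decide

/-- The permutation automorphisms of `RS(A, 3)` are the permutations fixing the last coordinate. -/
lemma image_eq_iff (π : Equiv.Perm (Fin 4)) :
    ((fun v : Fin 4 → ZMod 13 => fun i => v (π i)) ''
        {v : Fin 4 → ZMod 13 | ∃ f : (ZMod 13)[X], f.degree < (3 : ℕ) ∧
          v = fun i => f.eval ((![0, 1, 4, 6] : Fin 4 → ZMod 13) i)} =
      {v : Fin 4 → ZMod 13 | ∃ f : (ZMod 13)[X], f.degree < (3 : ℕ) ∧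
        v = fun i => f.eval ((![0, 1, 4, 6] : Fin 4 → ZMod 13) i)}) ↔ π 3 = 3 := by
  simp only [exists_degree_lt_three_iff]
  constructor
  · intro h
    exact apply_three_of_dual π (h.subset ⟨![3, 0, 0, 1], by decide, rfl⟩)
  · intro h
    ext w
    constructor
    · rintro ⟨v, hv, rfl⟩
      exact (dual_apply_perm h v).trans hv
    · intro hw
      have hinv : π⁻¹ 3 = 3 := by rw [Equiv.Perm.inv_eq_iff_eq, h]
      exact ⟨fun i => w (π⁻¹ i), (dual_apply_perm hinv w).trans hw, by simp⟩

/-- `Perm (Fin 3)` acting on the first three elements of `Fin 4`. -/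
def permFirstThree : Equiv.Perm (Fin 3) →* Equiv.Perm (Fin 4) :=
  Equiv.Perm.extendDomainHom (finSuccAboveEquiv (3 : Fin 4))

lemma permFirstThree_injective : Function.Injective permFirstThree :=
  Equiv.Perm.extendDomainHom_injective _

lemma mem_range_permFirstThree_iff (π : Equiv.Perm (Fin 4)) :
    π ∈ permFirstThree.range ↔ π 3 = 3 := by
  rw [MonoidHom.mem_range]
  constructor
  · rintro ⟨σ, rfl⟩
    exact Equiv.Perm.extendDomain_apply_not_subtype _ _ (by simp)
  · intro h
    have hmem (x : Fin 4) : π x ≠ 3 ↔ x ≠ 3 := by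
      rw [not_iff_not, ← π.injective.eq_iff (a := x), h]
    refine ⟨(finSuccAboveEquiv (3 : Fin 4)).symm.permCongr (π.subtypePerm hmem), ?_⟩
    ext x : 1
    by_cases hx : x = 3
    · rw [hx, h]
      exact Equiv.Perm.extendDomain_apply_not_subtype _ _ (by simp)
    · refine (Equiv.Perm.extendDomain_apply_subtype _ (finSuccAboveEquiv (3 : Fin 4)) hx).trans ?_
      simp [Equiv.permCongr_apply]

/-- The stabilizer of the last point of `Fin 4` is isomorphic to `Perm (Fin 3)`. -/
noncomputable def permFirstThreeEquiv : Equiv.Perm (Fin 3) ≃* permFirstThree.range :=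
  MonoidHom.ofInjective permFirstThree_injective

lemma affine_coeff_of_mapsTo : ∀ b c : ZMod 13, b ≠ 0 →
    (∀ i, ∃ j, ![0, 1, 4, 6] j = b * (![0, 1, 4, 6] : Fin 4 → ZMod 13) i + c) →
    (b = 1 ∧ c = 0) ∨ (b = 3 ∧ c = 1) ∨ (b = 9 ∧ c = 4) := by
  decide

lemma affine_degree_and_bijOn {b c : ZMod 13} (hb : b ≠ 0)
    (hmaps : ∀ i, ∃ j, ![0, 1, 4, 6] j = b * (![0, 1, 4, 6] : Fin 4 → ZMod 13) i + c) :
    (C b * X + C c).degree = 1 ∧ Set.BijOn (fun x => (C b * X + C c).eval x)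
      (Set.range ![0, 1, 4, 6]) (Set.range ![0, 1, 4, 6]) := by
  refine ⟨degree_linear hb, ?_⟩
  have hinj : Set.InjOn (fun x => (C b * X + C c).eval x)
      (Set.range (![0, 1, 4, 6] : Fin 4 → ZMod 13)) := by
    intro x _ y _ hxy
    have : Fact (Nat.Prime 13) := ⟨by norm_num⟩
    simpa [hb] using hxy
  have hmapsTo : Set.MapsTo (fun x => (C b * X + C c).eval x)
      (Set.range (![0, 1, 4, 6] : Fin 4 → ZMod 13)) (Set.range ![0, 1, 4, 6]) := by
    rintro _ ⟨i, rfl⟩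
    obtain ⟨j, hj⟩ := hmaps i
    exact ⟨j, by simpa using hj⟩
  exact ((Set.toFinite _).injOn_iff_bijOn_of_mapsTo hmapsTo).1 hinj

end ReedSolomonExample

open ReedSolomonExample in
/-- Over F_13, with A = (0,1,4,6) and k = 3 = n-1, the group
Per(RS(A,3)) is isomorphic to S_3, while the degree-one polynomials permuting
{0,1,4,6} are exactly x, 3x+1, 9x+4; in particular some element of
Per(RS(A,3)) is not an affine permutation of A. -/
theorem example_k_eq_n_sub_one
    (a : Fin 4 → ZMod 13) (haval : a = ![0, 1, 4, 6]) :
    (∃ Φ : {π : Equiv.Perm (Fin 4) //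
        (fun v : Fin 4 → ZMod 13 => fun i => v (π i)) ''
            {v : Fin 4 → ZMod 13 | ∃ f : (ZMod 13)[X], f.degree < (3 : ℕ) ∧
              v = fun i => f.eval (a i)} =
          {v : Fin 4 → ZMod 13 | ∃ f : (ZMod 13)[X], f.degree < (3 : ℕ) ∧
            v = fun i => f.eval (a i)}} →
      Equiv.Perm (Fin 3),
      Function.Bijective Φ ∧
      ∀ (π₁ π₂ : Equiv.Perm (Fin 4)) (h₁ : _) (h₂ : _) (h₁₂ : _),
        Φ ⟨π₁ * π₂, h₁₂⟩ = Φ ⟨π₁, h₁⟩ * Φ ⟨π₂, h₂⟩) ∧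
    ({p : (ZMod 13)[X] | p.degree = 1 ∧
        Set.BijOn (fun x => p.eval x) (Set.range a) (Set.range a)} =
      {X, Polynomial.C 3 * X + Polynomial.C 1, Polynomial.C 9 * X + Polynomial.C 4}) ∧
    (∃ π : Equiv.Perm (Fin 4),
      (fun v : Fin 4 → ZMod 13 => fun i => v (π i)) ''
          {v : Fin 4 → ZMod 13 | ∃ f : (ZMod 13)[X], f.degree < (3 : ℕ) ∧
            v = fun i => f.eval (a i)} =
        {v : Fin 4 → ZMod 13 | ∃ f : (ZMod 13)[X], f.degree < (3 : ℕ) ∧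
          v = fun i => f.eval (a i)} ∧
      ¬ ∃ p : (ZMod 13)[X], p.degree = 1 ∧ ∀ i, p.eval (a i) = a (π i)) := by
  subst haval
  refine ⟨⟨fun π => permFirstThreeEquiv.symm
    ⟨π.1, (mem_range_permFirstThree_iff π.1).2 ((image_eq_iff π.1).1 π.2)⟩,
    ⟨?_, ?_⟩, ?_⟩, ?_, ?_⟩
  · intro π₁ π₂ h
    have heq := permFirstThreeEquiv.symm.injective h
    exact Subtype.ext (congrArg (fun τ => τ.1) heq)
  · intro σ
    refine ⟨⟨permFirstThreeEquiv σ, (image_eq_iff _).2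
      ((mem_range_permFirstThree_iff _).1 (permFirstThreeEquiv σ).2)⟩, ?_⟩
    exact permFirstThreeEquiv.symm_apply_apply σ
  · intro π₁ π₂ h₁ h₂ h₁₂
    rw [← map_mul]
    rfl
  · ext p
    simp only [Set.mem_ofPred_eq, Set.mem_insert_iff, Set.mem_singleton_iff]
    constructor
    · rintro ⟨hdeg, hbij⟩
      obtain ⟨b, hb, c, rfl⟩ : ∃ b ≠ (0 : ZMod 13), ∃ c, C b * X + C c = p :=
        ⟨p.coeff 1, coeff_ne_zero_of_eq_degree hdeg, p.coeff 0,
          (eq_X_add_C_of_degree_le_one hdeg.le).symm⟩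
      have hmaps := affine_coeff_of_mapsTo b c hb fun i => by
        obtain ⟨j, hj⟩ := hbij.mapsTo (Set.mem_range_self i)
        exact ⟨j, by simpa using hj⟩
      rcases hmaps with ⟨rfl, rfl⟩ | ⟨rfl, rfl⟩ | ⟨rfl, rfl⟩ <;> simp
    · rintro (rfl | rfl | rfl)
      · simpa using affine_degree_and_bijOn (b := 1) (c := 0) (by decide) (by decide)
      · exact affine_degree_and_bijOn (by decide) (by decide)
      · exact affine_degree_and_bijOn (by decide) (by decide)
  · refine ⟨Equiv.swap 0 1, (image_eq_iff _).2 (by decide), ?_⟩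
    rintro ⟨p, hdeg, hp⟩
    rw [eq_X_add_C_of_degree_le_one hdeg.le] at hp
    generalize p.coeff 1 = b at hp
    generalize p.coeff 0 = c at hp
    simp only [eval_add, eval_mul, eval_C, eval_X] at hp
    revert b c
    decide
end
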